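/- arXiv:1512.06001 — 2 statements merged into one kernel-verified Lean document; each statement's English description precedes it below -/
import Mathlib

section
/- Let 𝒜 be an abelian category and let (𝒬, ℛ̃) and (𝒬̃, ℛ) be two complete hereditary cotorsion pairs in 𝒜 with equal cores (𝒬 ∩ ℛ̃ = 𝒬̃ ∩ ℛ) and with ℛ̃ ⊆ ℛ (equivalently, 𝒬̃ ⊆ 𝒬). Then there is a unique thick class 𝒲 for which (𝒬, 𝒲, ℛ) is a Hovey triple, i.e., for which 𝒲 ∩ ℛ = ℛ̃ and 𝒬 ∩ 𝒲 = 𝒬̃. Moreover, 𝒲 satisfies the two characterizations: 𝒲 = {X ∈ 𝒜 : there is a short exact sequence 0 → X → R → Q → 0 with R ∈ ℛ̃ and Q ∈ 𝒬̃} = {X ∈ 𝒜 : there is a short exact sequence 0 → R' → Q' → X → 0 with R' ∈ ℛ̃ and Q' ∈ 𝒬̃}. -/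
open CategoryTheory Limits ZeroObject

namespace AbModel

variable {A : Type*} [Category A] [Abelian A]

/-- `0 → X₁ → X₂ → X₃ → 0` given by `f, g` is a short exact sequence. -/
def IsSES {X₁ X₂ X₃ : A} (f : X₁ ⟶ X₂) (g : X₂ ⟶ X₃) : Prop :=
  ∃ w : f ≫ g = 0, (ShortComplex.mk f g w).ShortExact

/-- There exists a short exact sequence `0 → X₁ → X₂ → X₃ → 0`. -/
def SES (X₁ X₂ X₃ : A) : Prop :=
  ∃ (f : X₁ ⟶ X₂) (g : X₂ ⟶ X₃), IsSES f g

/-- `Ext¹(X, Y) = 0`, expressed as: every short exact sequence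
`0 → Y → Z → X → 0` splits. -/
def Ext1IsZero (X Y : A) : Prop :=
  ∀ ⦃Z : A⦄ (f : Y ⟶ Z) (g : Z ⟶ X) (w : f ≫ g = 0),
    (ShortComplex.mk f g w).ShortExact → Nonempty (ShortComplex.mk f g w).Splitting

/-- The right `Ext¹`-orthogonal class of a class of objects. -/
def rightPerp (S : Set A) : Set A := {Y | ∀ X ∈ S, Ext1IsZero X Y}

/-- The left `Ext¹`-orthogonal class of a class of objects. -/
def leftPerp (S : Set A) : Set A := {X | ∀ Y ∈ S, Ext1IsZero X Y}

/-- `(X, Y)` is a cotorsion pair. -/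
def IsCotorsionPair (X Y : Set A) : Prop :=
  X = leftPerp Y ∧ Y = rightPerp X

/-- Completeness of a pair of classes: every object has the two approximation
short exact sequences. -/
def IsCompletePair (X Y : Set A) : Prop :=
  (∀ M : A, ∃ Q W : A, Q ∈ X ∧ W ∈ Y ∧ SES W Q M) ∧
  (∀ M : A, ∃ Q W : A, Q ∈ X ∧ W ∈ Y ∧ SES M W Q)

/-- `(X, Y)` is a complete cotorsion pair. -/
def IsCompleteCotorsionPair (X Y : Set A) : Prop :=
  IsCotorsionPair X Y ∧ IsCompletePair X Y

/-- The hereditary condition on a pair of classes: the left class is closed under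
kernels of epimorphisms between its objects, and the right class is closed under
cokernels of monomorphisms between its objects. -/
def IsHereditaryPair (X Y : Set A) : Prop :=
  (∀ ⦃K B B' : A⦄, B ∈ X → B' ∈ X → SES K B B' → K ∈ X) ∧
  (∀ ⦃B B' Q : A⦄, B ∈ Y → B' ∈ Y → SES B B' Q → Q ∈ Y)

/-- A thick class: closed under direct summands (retracts) and satisfying
two-out-of-three for short exact sequences. -/
def IsThick (W : Set A) : Prop :=
  (∀ ⦃X Y : A⦄, Y ∈ W → (∃ (i : X ⟶ Y) (r : Y ⟶ X), i ≫ r = 𝟙 X) → X ∈ W) ∧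
  (∀ ⦃X Y Z : A⦄, SES X Y Z →
    (X ∈ W → Y ∈ W → Z ∈ W) ∧ (X ∈ W → Z ∈ W → Y ∈ W) ∧ (Y ∈ W → Z ∈ W → X ∈ W))

/-- A Hovey triple `(Q, W, R)`: `W` is thick and `(Q, W ∩ R)`, `(Q ∩ W, R)` are
complete cotorsion pairs. -/
def IsHoveyTriple (Q W R : Set A) : Prop :=
  IsThick W ∧ IsCompleteCotorsionPair Q (W ∩ R) ∧ IsCompleteCotorsionPair (Q ∩ W) R

/-- A hereditary Hovey triple. -/
def IsHereditaryHoveyTriple (Q W R : Set A) : Prop :=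
  IsHoveyTriple Q W R ∧ IsHereditaryPair Q (W ∩ R) ∧ IsHereditaryPair (Q ∩ W) R

namespace IsSES

variable {X₁ X₂ X₃ T P : A}

lemma zero {f : X₁ ⟶ X₂} {g : X₂ ⟶ X₃} (h : IsSES f g) : f ≫ g = 0 := h.1

lemma mono {f : X₁ ⟶ X₂} {g : X₂ ⟶ X₃} (h : IsSES f g) : Mono f := h.2.mono_f

lemma epi {f : X₁ ⟶ X₂} {g : X₂ ⟶ X₃} (h : IsSES f g) : Epi g := h.2.epi_g

lemma exists_lift {f : X₁ ⟶ X₂} {g : X₂ ⟶ X₃} (h : IsSES f g) (k : T ⟶ X₂)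
    (hk : k ≫ g = 0) : ∃ l : T ⟶ X₁, l ≫ f = k := by
  obtain ⟨w, hw⟩ := h
  exact ⟨_, (KernelFork.IsLimit.lift' hw.fIsKernel k hk).2⟩

lemma exists_desc {f : X₁ ⟶ X₂} {g : X₂ ⟶ X₃} (h : IsSES f g) (k : X₂ ⟶ T)
    (hk : f ≫ k = 0) : ∃ l : X₃ ⟶ T, g ≫ l = k := by
  obtain ⟨w, hw⟩ := h
  exact ⟨_, (CokernelCofork.IsColimit.desc' hw.gIsCokernel k hk).2⟩

lemma of_lift {f : X₁ ⟶ X₂} {g : X₂ ⟶ X₃} [Mono f] [Epi g] (w : f ≫ g = 0)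
    (hl : ∀ ⦃T : A⦄ (k : T ⟶ X₂), k ≫ g = 0 → ∃ l : T ⟶ X₁, l ≫ f = k) : IsSES f g :=
  ⟨w, .mk' (ShortComplex.exact_of_f_is_kernel _ (KernelFork.IsLimit.ofι' f w
    fun k hk => ⟨_, (hl k hk).choose_spec⟩)) ‹_› ‹_›⟩

lemma of_desc {f : X₁ ⟶ X₂} {g : X₂ ⟶ X₃} [Mono f] [Epi g] (w : f ≫ g = 0)
    (hl : ∀ ⦃T : A⦄ (k : X₂ ⟶ T), f ≫ k = 0 → ∃ l : X₃ ⟶ T, g ≫ l = k) : IsSES f g :=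
  ⟨w, .mk' (ShortComplex.exact_of_g_is_cokernel _ (CokernelCofork.IsColimit.ofπ' g w
    fun k hk => ⟨_, (hl k hk).choose_spec⟩)) ‹_› ‹_›⟩

/-- The base change of a short exact sequence along a morphism to its last term. -/
lemma of_isPullback {f : X₁ ⟶ X₂} {g : X₂ ⟶ X₃} (h : IsSES f g)
    {p : P ⟶ X₂} {q : P ⟶ T} {t : T ⟶ X₃} (sq : IsPullback p q g t) :
    ∃ f' : X₁ ⟶ P, f' ≫ p = f ∧ IsSES f' q := by
  have := h.mono
  have : Epi q := (MorphismProperty.epimorphisms A).of_isPullback sq h.epi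
  let f' : X₁ ⟶ P := sq.lift f 0 (by simp [h.zero])
  have hp : f' ≫ p = f := sq.lift_fst _ _ _
  have hq : f' ≫ q = 0 := sq.lift_snd _ _ _
  have : Mono f' := mono_of_mono_fac hp
  refine ⟨f', hp, of_lift hq fun U k hk => ?_⟩
  obtain ⟨l, hl⟩ := h.exists_lift (k ≫ p) (by rw [Category.assoc, sq.w, reassoc_of% hk, zero_comp])
  exact ⟨l, sq.hom_ext (by rw [Category.assoc, hp, hl]) (by rw [Category.assoc, hq, hk, comp_zero])⟩

/-- The preimage of the kernel of `g` under an epimorphism `f` is the kernel of `f ≫ g`. -/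
lemma comp_of_isPullback {f : X₁ ⟶ X₂} {K : A} {j : K ⟶ X₂} {g : X₂ ⟶ X₃} (h : IsSES j g) [Epi f]
    {p : P ⟶ X₁} {q : P ⟶ K} (sq : IsPullback p q f j) : IsSES p (f ≫ g) := by
  have := h.epi
  have : Mono p := (MorphismProperty.monomorphisms A).of_isPullback sq.flip h.mono
  have : Epi (f ≫ g) := epi_comp _ _
  refine of_lift (by rw [sq.w_assoc, h.zero, comp_zero]) fun U k hk => ?_
  obtain ⟨l, hl⟩ := h.exists_lift (k ≫ f) (by simpa using hk)
  exact ⟨sq.lift k l hl.symm, sq.lift_fst _ _ _⟩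

/-- The cobase change of a short exact sequence along a morphism from its first term. -/
lemma of_isPushout {f : X₁ ⟶ X₂} {g : X₂ ⟶ X₃} (h : IsSES f g)
    {t : X₁ ⟶ T} {p : X₂ ⟶ P} {q : T ⟶ P} (sq : IsPushout f t p q) :
    ∃ g' : P ⟶ X₃, p ≫ g' = g ∧ IsSES q g' := by
  have := h.epi
  have : Mono q := (MorphismProperty.monomorphisms A).of_isPushout sq.flip h.mono
  let g' : P ⟶ X₃ := sq.desc g 0 (by simp [h.zero])
  have hp : p ≫ g' = g := sq.inl_desc _ _ _
  have hq : q ≫ g' = 0 := sq.inr_desc _ _ _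
  have : Epi g' := epi_of_epi_fac hp
  refine ⟨g', hp, of_desc hq fun U k hk => ?_⟩
  obtain ⟨l, hl⟩ := h.exists_desc (p ≫ k) (by rw [sq.w_assoc, hk, comp_zero])
  exact ⟨l, sq.hom_ext (by rw [reassoc_of% hp, hl]) (by rw [reassoc_of% hq, hk, zero_comp])⟩

/-- The cobase change along a monomorphism `f` of a cokernel of `g` is a cokernel of `g ≫ f`. -/
lemma comp_of_isPushout {g : X₁ ⟶ X₂} {f : X₂ ⟶ X₃} {C : A} {j : X₂ ⟶ C} (h : IsSES g j) [Mono f]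
    {p : X₃ ⟶ P} {q : C ⟶ P} (sq : IsPushout f j p q) : IsSES (g ≫ f) p := by
  have := h.mono
  have : Epi p := (MorphismProperty.epimorphisms A).of_isPushout sq h.epi
  have : Mono (g ≫ f) := mono_comp _ _
  refine of_desc (by rw [Category.assoc, sq.w, reassoc_of% h.zero, zero_comp]) fun U k hk => ?_
  obtain ⟨l, hl⟩ := h.exists_desc (f ≫ k) (by simpa using hk)
  exact ⟨sq.desc k l hl.symm, sq.inl_desc _ _ _⟩

end IsSES

lemma SES.id_zero (X : A) : SES X X (0 : A) :=
  ⟨𝟙 X, 0, .of_lift (by simp) fun _ k _ => ⟨k, by simp⟩⟩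

lemma SES.zero_id (X : A) : SES (0 : A) X X :=
  ⟨0, 𝟙 X, .of_desc (by simp) fun _ k _ => ⟨k, by simp⟩⟩

namespace Ext1IsZero

variable {X Y Z : A}

lemma of_section (h : ∀ ⦃Z : A⦄ (f : Y ⟶ Z) (g : Z ⟶ X), IsSES f g → ∃ s : X ⟶ Z, s ≫ g = 𝟙 X) :
    Ext1IsZero X Y := fun _ f g w hw =>
  ⟨.ofExactOfSection _ hw.exact _ (h f g ⟨w, hw⟩).choose_spec hw.mono_f⟩

lemma of_retraction
    (h : ∀ ⦃Z : A⦄ (f : Y ⟶ Z) (g : Z ⟶ X), IsSES f g → ∃ r : Z ⟶ Y, f ≫ r = 𝟙 Y) :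
    Ext1IsZero X Y := fun _ f g w hw =>
  ⟨.ofExactOfRetraction _ hw.exact _ (h f g ⟨w, hw⟩).choose_spec hw.epi_g⟩

lemma exists_section (h : Ext1IsZero X Y) {f : Y ⟶ Z} {g : Z ⟶ X} (hfg : IsSES f g) :
    ∃ s : X ⟶ Z, s ≫ g = 𝟙 X :=
  let ⟨σ⟩ := h f g hfg.1 hfg.2
  ⟨σ.s, σ.s_g⟩

lemma exists_retraction (h : Ext1IsZero X Y) {f : Y ⟶ Z} {g : Z ⟶ X} (hfg : IsSES f g) :
    ∃ r : Z ⟶ Y, f ≫ r = 𝟙 Y :=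
  let ⟨σ⟩ := h f g hfg.1 hfg.2
  ⟨σ.r, σ.f_r⟩

lemma exists_lift (h : Ext1IsZero X Y) {W : A} {f : Y ⟶ Z} {g : Z ⟶ W} (hfg : IsSES f g)
    (t : X ⟶ W) : ∃ l : X ⟶ Z, l ≫ g = t := by
  have sq := IsPullback.of_hasPullback g t
  obtain ⟨f', -, hf'⟩ := hfg.of_isPullback sq
  obtain ⟨s, hs⟩ := h.exists_section hf'
  exact ⟨s ≫ pullback.fst g t, by rw [Category.assoc, sq.w, reassoc_of% hs]⟩

lemma exists_desc (h : Ext1IsZero X Y) {W : A} {f : W ⟶ Z} {g : Z ⟶ X} (hfg : IsSES f g)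
    (t : W ⟶ Y) : ∃ l : Z ⟶ Y, f ≫ l = t := by
  have sq := IsPushout.of_hasPushout f t
  obtain ⟨g', -, hg'⟩ := hfg.of_isPushout sq
  obtain ⟨r, hr⟩ := h.exists_retraction hg'
  exact ⟨pushout.inl f t ≫ r, by rw [sq.w_assoc, hr, Category.comp_id]⟩

lemma extension_right {Y₁ Y₂ : A} (h₁ : Ext1IsZero X Y₁) (h₂ : Ext1IsZero X Y₂)
    (h : SES Y₁ Y Y₂) : Ext1IsZero X Y := by
  obtain ⟨a, b, hab⟩ := h
  refine of_section fun Z f g hfg => ?_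
  have := hfg.mono
  have sq := IsPushout.of_hasPushout f b
  obtain ⟨g', hg, hg'⟩ := hfg.of_isPushout sq
  obtain ⟨s, hs⟩ := h₂.exists_section hg'
  obtain ⟨l, hl⟩ := h₁.exists_lift (hab.comp_of_isPushout sq) s
  exact ⟨l, by rw [← hg, reassoc_of% hl, hs]⟩

lemma extension_left {X₁ X₂ : A} (h₁ : Ext1IsZero X₁ Y) (h₂ : Ext1IsZero X₂ Y)
    (h : SES X₁ X X₂) : Ext1IsZero X Y := by
  obtain ⟨a, b, hab⟩ := h
  refine of_retraction fun Z f g hfg => ?_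
  have := hfg.epi
  have sq := IsPullback.of_hasPullback g a
  obtain ⟨f', hf, hf'⟩ := hfg.of_isPullback sq
  obtain ⟨r, hr⟩ := h₁.exists_retraction hf'
  obtain ⟨l, hl⟩ := h₂.exists_desc (hab.comp_of_isPullback sq) r
  exact ⟨l, by rw [← hf, Category.assoc, hl, hr]⟩

lemma retract_left {X' : A} (h : Ext1IsZero X' Y) (i : X ⟶ X') (r : X' ⟶ X) (hir : i ≫ r = 𝟙 X) :
    Ext1IsZero X Y := of_section fun _ _ _ hfg =>
  let ⟨l, hl⟩ := h.exists_lift hfg r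
  ⟨i ≫ l, by rw [Category.assoc, hl, hir]⟩

lemma retract_right {Y' : A} (h : Ext1IsZero X Y') (i : Y ⟶ Y') (r : Y' ⟶ Y) (hir : i ≫ r = 𝟙 Y) :
    Ext1IsZero X Y := of_retraction fun _ _ _ hfg =>
  let ⟨l, hl⟩ := h.exists_desc hfg i
  ⟨l ≫ r, by rw [reassoc_of% hl, hir]⟩

end Ext1IsZero

namespace IsCotorsionPair

variable {S T : Set A}

lemma ext1IsZero (h : IsCotorsionPair S T) {X Y : A} (hX : X ∈ S) (hY : Y ∈ T) :
    Ext1IsZero X Y := (h.1 ▸ hX : X ∈ leftPerp T) Y hY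

lemma mem_left_iff (h : IsCotorsionPair S T) {X : A} : X ∈ S ↔ ∀ Y ∈ T, Ext1IsZero X Y :=
  Set.ext_iff.1 h.1 X

lemma mem_right_iff (h : IsCotorsionPair S T) {Y : A} : Y ∈ T ↔ ∀ X ∈ S, Ext1IsZero X Y :=
  Set.ext_iff.1 h.2 Y

lemma left_extension (h : IsCotorsionPair S T) {X Y Z : A} (hX : X ∈ S) (hZ : Z ∈ S)
    (hs : SES X Y Z) : Y ∈ S :=
  h.mem_left_iff.2 fun _ hW => (h.ext1IsZero hX hW).extension_left (h.ext1IsZero hZ hW) hs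

lemma right_extension (h : IsCotorsionPair S T) {X Y Z : A} (hX : X ∈ T) (hZ : Z ∈ T)
    (hs : SES X Y Z) : Y ∈ T :=
  h.mem_right_iff.2 fun _ hW => (h.ext1IsZero hW hX).extension_right (h.ext1IsZero hW hZ) hs

lemma left_retract (h : IsCotorsionPair S T) {X Y : A} (hY : Y ∈ S) (i : X ⟶ Y) (r : Y ⟶ X)
    (hir : i ≫ r = 𝟙 X) : X ∈ S :=
  h.mem_left_iff.2 fun _ hW => (h.ext1IsZero hY hW).retract_left i r hir

lemma right_retract (h : IsCotorsionPair S T) {X Y : A} (hY : Y ∈ T) (i : X ⟶ Y) (r : Y ⟶ X)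
    (hir : i ≫ r = 𝟙 X) : X ∈ T :=
  h.mem_right_iff.2 fun _ hW => (h.ext1IsZero hW hY).retract_right i r hir

lemma zero_mem_left (h : IsCotorsionPair S T) : (0 : A) ∈ S :=
  h.mem_left_iff.2 fun _ _ => .of_section fun _ _ _ _ => ⟨0, (isZero_zero A).eq_of_src _ _⟩

lemma zero_mem_right (h : IsCotorsionPair S T) : (0 : A) ∈ T :=
  h.mem_right_iff.2 fun _ _ => .of_retraction fun _ _ _ _ => ⟨0, (isZero_zero A).eq_of_src _ _⟩

lemma left_antitone {S' T' : Set A} (h : IsCotorsionPair S T) (h' : IsCotorsionPair S' T')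
    (hT : T ⊆ T') : S' ⊆ S :=
  fun _ hX => h.mem_left_iff.2 fun _ hY => h'.ext1IsZero hX (hT hY)

end IsCotorsionPair

/-- `f` is an epimorphism whose kernel belongs to `T`. -/
def EpiWithKernelIn (T : Set A) {X Y : A} (f : X ⟶ Y) : Prop :=
  ∃ K ∈ T, ∃ i : K ⟶ X, IsSES i f

namespace EpiWithKernelIn

variable {S T : Set A} {X Y Z : A}

lemma comp (hST : IsCotorsionPair S T) {f : X ⟶ Y} {g : Y ⟶ Z} (hf : EpiWithKernelIn T f)
    (hg : EpiWithKernelIn T g) : EpiWithKernelIn T (f ≫ g) := by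
  obtain ⟨K, hK, i, hi⟩ := hf
  obtain ⟨L, hL, j, hj⟩ := hg
  have := hi.epi
  have sq := IsPullback.of_hasPullback f j
  obtain ⟨i', -, hi'⟩ := hi.of_isPullback sq
  exact ⟨_, hST.right_extension hK hL ⟨_, _, hi'⟩, _, hj.comp_of_isPullback sq⟩

lemma of_isPullback {P U : A} {g : Y ⟶ Z} (hg : EpiWithKernelIn T g) {p : P ⟶ Y} {q : P ⟶ U}
    {t : U ⟶ Z} (sq : IsPullback p q g t) : EpiWithKernelIn T q :=
  let ⟨K, hK, _, hi⟩ := hg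
  let ⟨i', _, hi'⟩ := hi.of_isPullback sq
  ⟨K, hK, i', hi'⟩

lemma exists_lift (hST : IsCotorsionPair S T) {f : X ⟶ Y} (hf : EpiWithKernelIn T f)
    (hZ : Z ∈ S) (t : Z ⟶ Y) : ∃ l : Z ⟶ X, l ≫ f = t :=
  let ⟨_, hK, _, hi⟩ := hf
  (hST.ext1IsZero hZ hK).exists_lift hi t

end EpiWithKernelIn

lemma IsCompleteCotorsionPair.exists_epiWithKernelIn {S T : Set A}
    (h : IsCompleteCotorsionPair S T) (X : A) :
    ∃ Q ∈ S, ∃ f : Q ⟶ X, EpiWithKernelIn T f :=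
  let ⟨Q, W, hQ, hW, i, f, hif⟩ := h.2.1 X
  ⟨Q, hQ, f, W, hW, i, hif⟩

/-- A short exact sequence can be approximated from the left by one in the left class of
a complete hereditary cotorsion pair. -/
lemma IsCompleteCotorsionPair.exists_ses_epiWithKernelIn {S T : Set A}
    (h : IsCompleteCotorsionPair S T) (hher : IsHereditaryPair S T) {X Y Z : A} (hs : SES X Y Z) :
    ∃ K ∈ S, ∃ B ∈ S, ∃ C ∈ S, SES K B C ∧ (∃ f : K ⟶ X, EpiWithKernelIn T f) ∧
      (∃ f : B ⟶ Y, EpiWithKernelIn T f) ∧ ∃ f : C ⟶ Z, EpiWithKernelIn T f := by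
  obtain ⟨a, b, hab⟩ := hs
  obtain ⟨C, hC, c, hc⟩ := h.exists_epiWithKernelIn Z
  have sq := IsPullback.of_hasPullback b c
  obtain ⟨a', -, ha'⟩ := hab.of_isPullback sq
  obtain ⟨B, hB, e, he⟩ := h.exists_epiWithKernelIn (pullback b c)
  have : Epi e := let ⟨_, _, _, hi⟩ := he; hi.epi
  have sq' := IsPullback.of_hasPullback e a'
  have hK := ha'.comp_of_isPullback sq'
  exact ⟨_, hher.1 hB hC ⟨_, _, hK⟩, B, hB, C, hC, ⟨_, _, hK⟩, ⟨_, he.of_isPullback sq'⟩,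
    ⟨_, he.comp h.1 (hc.of_isPullback sq.flip)⟩, c, hc⟩

section TwoCotorsionPairs

variable {Q Rt Qt R : Set A}

lemma mem_left_of_epiWithKernelIn (h₁ : IsCompleteCotorsionPair Q Rt)
    (h₁her : IsHereditaryPair Q Rt) (h₂ : IsCotorsionPair Qt R) (hcore : Q ∩ Rt ⊆ Qt)
    (hQ : Qt ⊆ Q) {X Y Y' : A} (hY : Y ∈ Qt) (hY' : Y' ∈ Q) {f : Y ⟶ X} {f' : Y' ⟶ X}
    (hf : EpiWithKernelIn Rt f) (hf' : EpiWithKernelIn Rt f') : Y' ∈ Qt := by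
  have sq := IsPullback.of_hasPullback f f'
  obtain ⟨B, hB, e, he⟩ := h₁.exists_epiWithKernelIn (pullback f f')
  obtain ⟨K, hK, i, hi⟩ := he.comp h₁.1 (hf'.of_isPullback sq.flip)
  have hB' : B ∈ Qt := h₂.left_extension (hcore ⟨h₁her.1 hB (hQ hY) ⟨_, _, hi⟩, hK⟩) hY ⟨_, _, hi⟩
  obtain ⟨s, hs⟩ := (he.comp h₁.1 (hf.of_isPullback sq)).exists_lift h₁.1 hY' (𝟙 _)
  exact h₂.left_retract hB' s _ hs

lemma mem_left_of_ses (h₁ : IsCotorsionPair Q Rt) (h₂ : IsCompleteCotorsionPair Qt R)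
    (hcore : Qt ∩ R ⊆ Rt) {X Y Z : A} (hX : X ∈ Qt) (hY : Y ∈ Qt) (hZ : Z ∈ Q)
    (hs : SES X Y Z) : Z ∈ Qt := by
  obtain ⟨a, b, hab⟩ := hs
  obtain ⟨E, F, hE, hF, c, d, hcd⟩ := h₂.2.2 X
  have hFR : F ∈ Rt := hcore ⟨h₂.1.left_extension hX hE ⟨_, _, hcd⟩, hF⟩
  have sq := IsPushout.of_hasPushout a c
  obtain ⟨g, -, hg⟩ := hab.of_isPushout sq
  obtain ⟨g', -, hg'⟩ := hcd.of_isPushout sq.flip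
  obtain ⟨s, hs⟩ := (h₁.ext1IsZero hZ hFR).exists_section hg
  exact h₂.1.left_retract (h₂.1.left_extension hY hE ⟨_, _, hg'⟩) s g hs

/-- The objects that are quotients of an object of `Qt` by a subobject in `Rt`. -/
def trivialObjects (Qt Rt : Set A) : Set A :=
  {X | ∃ Rr Qq : A, Rr ∈ Rt ∧ Qq ∈ Qt ∧ SES Rr Qq X}

lemma mem_trivialObjects_iff {X : A} :
    X ∈ trivialObjects Qt Rt ↔ ∃ Y ∈ Qt, ∃ f : Y ⟶ X, EpiWithKernelIn Rt f :=
  ⟨fun ⟨_, Y, hK, hY, i, f, h⟩ => ⟨Y, hY, f, _, hK, i, h⟩,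
    fun ⟨Y, hY, f, _, hK, i, h⟩ => ⟨_, Y, hK, hY, i, f, h⟩⟩

lemma mem_trivialObjects_iff_of_epiWithKernelIn (h₁ : IsCompleteCotorsionPair Q Rt)
    (h₁her : IsHereditaryPair Q Rt) (h₂ : IsCotorsionPair Qt R) (hcore : Q ∩ Rt ⊆ Qt)
    (hQ : Qt ⊆ Q) {X Y : A} (hY : Y ∈ Q) {f : Y ⟶ X} (hf : EpiWithKernelIn Rt f) :
    X ∈ trivialObjects Qt Rt ↔ Y ∈ Qt :=
  mem_trivialObjects_iff.trans
    ⟨fun ⟨_, hY', _, hf'⟩ => mem_left_of_epiWithKernelIn h₁ h₁her h₂ hcore hQ hY' hY hf' hf,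
      fun h => ⟨Y, h, f, hf⟩⟩

lemma isThick_trivialObjects (h₁ : IsCompleteCotorsionPair Q Rt)
    (h₁her : IsHereditaryPair Q Rt) (h₂ : IsCompleteCotorsionPair Qt R)
    (h₂her : IsHereditaryPair Qt R) (hcore : Q ∩ Rt = Qt ∩ R) (hQ : Qt ⊆ Q) :
    IsThick (trivialObjects Qt Rt) := by
  have hω : Q ∩ Rt ⊆ Qt := fun X hX => (hcore.subset hX).1
  have hω' : Qt ∩ R ⊆ Rt := fun X hX => (hcore.superset hX).2
  refine ⟨fun X Y hY ⟨i, r, hir⟩ => ?_, fun X Y Z hs => ?_⟩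
  · obtain ⟨B, hB, c, hc⟩ := h₁.exists_epiWithKernelIn X
    have sq := IsPullback.of_hasPullback r c
    obtain ⟨E, hE, e, he⟩ := h₁.exists_epiWithKernelIn (pullback r c)
    have hE' : E ∈ Qt := (mem_trivialObjects_iff_of_epiWithKernelIn h₁ h₁her h₂.1 hω hQ hE
      (he.comp h₁.1 (hc.of_isPullback sq.flip))).1 hY
    obtain ⟨l, hl⟩ := he.exists_lift h₁.1 hB
      (sq.lift (c ≫ i) (𝟙 B) (by rw [Category.assoc, hir, Category.comp_id, Category.id_comp]))
    exact mem_trivialObjects_iff.2 ⟨B, h₂.1.left_retract hE' l (e ≫ pullback.snd r c)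
      (by rw [reassoc_of% hl, sq.lift_snd]), c, hc⟩
  · obtain ⟨K, hK, B, hB, C, hC, hs', ⟨f, hf⟩, ⟨g, hg⟩, k, hk⟩ :=
      h₁.exists_ses_epiWithKernelIn h₁her hs
    rw [mem_trivialObjects_iff_of_epiWithKernelIn h₁ h₁her h₂.1 hω hQ hK hf,
      mem_trivialObjects_iff_of_epiWithKernelIn h₁ h₁her h₂.1 hω hQ hB hg,
      mem_trivialObjects_iff_of_epiWithKernelIn h₁ h₁her h₂.1 hω hQ hC hk]
    exact ⟨fun h h' => mem_left_of_ses h₁.1 h₂ hω' h h' hC hs',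
      fun h h' => h₂.1.left_extension h h' hs', fun h h' => h₂her.1 h h' hs'⟩

lemma trivialObjects_eq (h₁ : IsCompleteCotorsionPair Q Rt)
    (h₁her : IsHereditaryPair Q Rt) (h₂ : IsCompleteCotorsionPair Qt R)
    (h₂her : IsHereditaryPair Qt R) (hcore : Q ∩ Rt = Qt ∩ R) :
    trivialObjects Qt Rt = {X | ∃ Rr Qq : A, Rr ∈ Rt ∧ Qq ∈ Qt ∧ SES X Rr Qq} := by
  ext X
  constructor
  · rintro ⟨K, Y, hK, hY, x, y, hxy⟩
    obtain ⟨E, F, hE, hF, c, d, hcd⟩ := h₂.2.2 Y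
    have hFR : F ∈ Rt := (hcore.superset ⟨h₂.1.left_extension hY hE ⟨_, _, hcd⟩, hF⟩).2
    have := hcd.mono
    have sq := IsPushout.of_hasPushout c y
    obtain ⟨d', -, hd'⟩ := hcd.of_isPushout sq
    exact ⟨_, E, h₁her.2 hK hFR ⟨_, _, hxy.comp_of_isPushout sq⟩, hE, _, _, hd'⟩
  · rintro ⟨Y, C, hY, hC, x, y, hxy⟩
    obtain ⟨F, E, hF, hE, a, c, hac⟩ := h₁.2.1 Y
    have hFQ : F ∈ Qt := (hcore.subset ⟨hF, h₁.1.right_extension hE hY ⟨_, _, hac⟩⟩).1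
    have := hac.epi
    have sq := IsPullback.of_hasPullback c x
    obtain ⟨a', -, ha'⟩ := hac.of_isPullback sq
    exact ⟨E, _, hE, h₂her.1 hFQ hC ⟨_, _, hxy.comp_of_isPullback sq⟩, _, _, ha'⟩

lemma left_inter_trivialObjects (h₁ : IsCotorsionPair Q Rt) (h₂ : IsCotorsionPair Qt R)
    (hQ : Qt ⊆ Q) : Q ∩ trivialObjects Qt Rt = Qt := by
  refine Set.Subset.antisymm ?_ fun X hX => ⟨hQ hX, 0, X, h₁.zero_mem_right, hX, .zero_id X⟩
  rintro X ⟨hX, K, Y, hK, hY, x, y, hxy⟩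
  obtain ⟨s, hs⟩ := (h₁.ext1IsZero hX hK).exists_section hxy
  exact h₂.left_retract hY s y hs

end TwoCotorsionPairs

end AbModel

open AbModel

/-- Theorem (Gillespie, "How to construct a Hovey triple from two cotorsion pairs"):
given two complete hereditary cotorsion pairs `(Q, Rt)` and `(Qt, R)` in an abelian
category, with equal cores `Q ∩ Rt = Qt ∩ R` and with `Rt ⊆ R`, there is a unique
thick class `W` for which `(Q, W, R)` is a Hovey triple; it satisfies `W ∩ R = Rt` and
`Q ∩ W = Qt`, and admits the two stated characterizations by short exact sequences. -/
theorem hovey_triple_from_two_cotorsion_pairs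
    {A : Type*} [Category A] [Abelian A] {Q Rt Qt R : Set A}
    (h₁ : IsCompleteCotorsionPair Q Rt) (h₁her : IsHereditaryPair Q Rt)
    (h₂ : IsCompleteCotorsionPair Qt R) (h₂her : IsHereditaryPair Qt R)
    (hcore : Q ∩ Rt = Qt ∩ R) (hsub : Rt ⊆ R) :
    ∃ W : Set A, IsThick W ∧ IsHoveyTriple Q W R ∧
      W ∩ R = Rt ∧ Q ∩ W = Qt ∧
      W = {X | ∃ Rr Qq : A, Rr ∈ Rt ∧ Qq ∈ Qt ∧ SES X Rr Qq} ∧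
      W = {X | ∃ Rr Qq : A, Rr ∈ Rt ∧ Qq ∈ Qt ∧ SES Rr Qq X} ∧
      ∀ W' : Set A, IsThick W' → IsHoveyTriple Q W' R → W' = W := by
  have hQ : Qt ⊆ Q := h₁.1.left_antitone h₂.1 hsub
  have hthick := isThick_trivialObjects h₁ h₁her h₂ h₂her hcore hQ
  have heq := trivialObjects_eq h₁ h₁her h₂ h₂her hcore
  have hWQ : Q ∩ trivialObjects Qt Rt = Qt := left_inter_trivialObjects h₁.1 h₂.1 hQ
  have hWR : trivialObjects Qt Rt ∩ R = Rt := by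
    rw [heq]
    refine Set.Subset.antisymm ?_ fun X hX => ⟨⟨X, 0, hX, h₂.1.zero_mem_left, .id_zero X⟩, hsub hX⟩
    rintro X ⟨⟨Y, C, hY, hC, x, y, hxy⟩, hX⟩
    obtain ⟨r, hr⟩ := (h₂.1.ext1IsZero hC hX).exists_retraction hxy
    exact h₁.1.right_retract hY x r hr
  refine ⟨trivialObjects Qt Rt, hthick, ⟨hthick, by rwa [hWR], by rwa [hWQ]⟩, hWR, hWQ, heq, rfl,
    fun W hW hH => ?_⟩
  have hRt : W ∩ R = Rt := hH.2.1.1.2.trans h₁.1.2.symm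
  have hQt : Q ∩ W = Qt := hH.2.2.1.1.trans h₂.1.1.symm
  ext X
  constructor
  · intro hX
    obtain ⟨Y, K, hY, hK, hs⟩ := h₁.2.1 X
    exact ⟨K, Y, hK, hQt.subset ⟨hY, (hW.2 hs).2.1 (hRt.superset hK).1 hX⟩, hs⟩
  · rintro ⟨K, Y, hK, hY, hs⟩
    exact (hW.2 hs).1 (hRt.superset hK).1 (hQt.superset hY).2
end

section
/- Let 𝒜 be an abelian category, let (𝒬, 𝒲, ℛ) be a hereditary Hovey triple in 𝒜, and set ω = 𝒬 ∩ 𝒲 ∩ ℛ. Then the full subcategory 𝒬 ∩ ℛ, with the short exact sequences having all three terms in 𝒬 ∩ ℛ, is a Frobenius category whose projective-injective objects are exactly the objects of ω. Concretely: (1) every short exact sequence 0 → X → Y → Z → 0 with X, Y, Z ∈ 𝒬 ∩ ℛ splits whenever X ∈ ω or Z ∈ ω; (2) if I ∈ 𝒬 ∩ ℛ and every short exact sequence 0 → I → Y → Z → 0 with Y, Z ∈ 𝒬 ∩ ℛ splits, then I ∈ ω; (3) if P ∈ 𝒬 ∩ ℛ and every short exact sequence 0 → X → Y → P → 0 with X,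 Y ∈ 𝒬 ∩ ℛ splits, then P ∈ ω; (4) for every X ∈ 𝒬 ∩ ℛ there is a short exact sequence 0 → X → W → Q → 0 with W ∈ ω and Q ∈ 𝒬 ∩ ℛ, and a short exact sequence 0 → R → W' → X → 0 with W' ∈ ω and R ∈ 𝒬 ∩ ℛ. -/
open CategoryTheory Limits ZeroObject

open AbModel

open Opposite

namespace AbModel

section Ext1

variable {A : Type*} [Category A] [Abelian A]

/-- If `Ext¹(X, Y) = 0`, then morphisms to `Y` extend along monomorphisms with cokernel `X`. -/
lemma Ext1IsZero.exists_extension {X Y X₁ X₂ : A} (h : Ext1IsZero X Y)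
    {f : X₁ ⟶ X₂} {g : X₂ ⟶ X} (hfg : IsSES f g) (φ : X₁ ⟶ Y) :
    ∃ ψ : X₂ ⟶ Y, f ≫ ψ = φ := by
  obtain ⟨w, hS⟩ := hfg
  have hf : Mono f := hS.mono_f
  have hg : Epi g := hS.epi_g
  have w' : pushout.inr f φ ≫ pushout.desc g 0 (by simp [w]) = 0 :=
    pushout.inr_desc _ _ _
  have hepi : Epi (pushout.inl f φ ≫ pushout.desc g (0 : Y ⟶ X) (by simp [w])) := by
    rw [pushout.inl_desc]; exact hg
  have hP : (ShortComplex.mk _ _ w').ShortExact := by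
    refine ShortComplex.ShortExact.mk' ?_ inferInstance (epi_of_epi (pushout.inl f φ) _)
    refine ShortComplex.exact_of_g_is_cokernel _ (CokernelCofork.IsColimit.ofπ _ w'
      (fun k hk ↦ hS.exact.desc (pushout.inl f φ ≫ k) ?_) (fun k hk ↦ ?_)
      (fun k hk m hm ↦ ?_))
    · dsimp
      rw [pushout.condition_assoc, hk, comp_zero]
    · apply pushout.hom_ext
      · rw [pushout.inl_desc_assoc]
        exact hS.exact.g_desc _ _
      · rw [pushout.inr_desc_assoc, zero_comp, hk]
    · rw [← cancel_epi g]
      refine Eq.trans ?_ (hS.exact.g_desc _ _).symm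
      rw [← hm, pushout.inl_desc_assoc]
  obtain ⟨s⟩ := h _ _ w' hP
  refine ⟨pushout.inl f φ ≫ s.r, ?_⟩
  have hr : pushout.inr f φ ≫ s.r = 𝟙 Y := s.f_r
  rw [pushout.condition_assoc, hr, Category.comp_id]

/-- The objects `X` with `Ext¹(X, Y) = 0` are closed under extensions. -/
lemma Ext1IsZero.of_ses_left {X' X X'' Y : A} (hX : SES X' X X'')
    (h' : Ext1IsZero X' Y) (h'' : Ext1IsZero X'' Y) : Ext1IsZero X Y := by
  intro E f g w hS
  obtain ⟨a, b, wab, hab⟩ := hX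
  have hf : Mono f := hS.mono_f
  have hg : Epi g := hS.epi_g
  have ha : Mono a := hab.mono_f
  have hb : Epi b := hab.epi_g
  have w₁ : pullback.lift f 0 (by simp [w]) ≫ pullback.snd g a = 0 :=
    pullback.lift_snd _ _ _
  have hmono : Mono (pullback.lift f (0 : Y ⟶ X') (by simp [w]) ≫ pullback.fst g a) := by
    rw [pullback.lift_fst]; exact hf
  have h₁ : (ShortComplex.mk _ _ w₁).ShortExact := by
    refine ShortComplex.ShortExact.mk' ?_ (mono_of_mono _ (pullback.fst g a)) inferInstance
    refine ShortComplex.exact_of_f_is_kernel _ (KernelFork.IsLimit.ofι _ w₁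
      (fun k hk ↦ hS.exact.lift (k ≫ pullback.fst g a) ?_) (fun k hk ↦ ?_)
      (fun k hk m hm ↦ ?_))
    · dsimp
      rw [Category.assoc, pullback.condition, reassoc_of% hk, zero_comp]
    · apply pullback.hom_ext
      · rw [Category.assoc, pullback.lift_fst]
        exact hS.exact.lift_f _ _
      · rw [Category.assoc, pullback.lift_snd, comp_zero, hk]
    · rw [← cancel_mono f]
      refine Eq.trans ?_ (hS.exact.lift_f _ _).symm
      rw [← hm, Category.assoc, pullback.lift_fst]
  have w₂ : pullback.fst g a ≫ g ≫ b = 0 := by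
    rw [pullback.condition_assoc, wab, comp_zero]
  have h₂ : (ShortComplex.mk _ _ w₂).ShortExact := by
    refine ShortComplex.ShortExact.mk' ?_ inferInstance (epi_comp g b)
    refine ShortComplex.exact_of_f_is_kernel _ (KernelFork.IsLimit.ofι' _ w₂ fun k hk ↦
      ⟨pullback.lift k (hab.exact.lift (k ≫ g) ?_) ?_, ?_⟩)
    · simpa using hk
    · exact (hab.exact.lift_f _ _).symm
    · exact pullback.lift_fst _ _ _
  obtain ⟨s⟩ := h' _ _ w₁ h₁
  obtain ⟨ψ, hψ⟩ := h''.exists_extension ⟨w₂, h₂⟩ s.r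
  have hr : pullback.lift f 0 (by simp [w]) ≫ s.r = 𝟙 Y := s.f_r
  refine ⟨ShortComplex.Splitting.ofExactOfRetraction _ hS.exact ψ ?_ hg⟩
  dsimp
  rw [← hr, ← hψ, pullback.lift_fst_assoc]

lemma Ext1IsZero.op {X Y : A} (h : Ext1IsZero X Y) : Ext1IsZero (op Y) (op X) := by
  intro Z f g w hS
  obtain ⟨s⟩ := h g.unop f.unop (by rw [← unop_comp, w, unop_zero]) hS.unop
  exact ⟨s.op⟩

lemma Ext1IsZero.unop {X Y : A} (h : Ext1IsZero (Opposite.op Y) (Opposite.op X)) :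
    Ext1IsZero X Y := by
  intro Z f g w hS
  obtain ⟨s⟩ := h g.op f.op (by rw [← op_comp, w, op_zero]) hS.op
  exact ⟨s.unop⟩

lemma SES.op {X Y Z : A} (h : SES X Y Z) :
    SES (Opposite.op Z) (Opposite.op Y) (Opposite.op X) := by
  obtain ⟨f, g, w, hS⟩ := h
  exact ⟨g.op, f.op, by rw [← op_comp, w, op_zero], hS.op⟩

/-- The objects `Y` with `Ext¹(X, Y) = 0` are closed under extensions. -/
lemma Ext1IsZero.of_ses_right {X Y' Y Y'' : A} (hY : SES Y' Y Y'')
    (h' : Ext1IsZero X Y') (h'' : Ext1IsZero X Y'') : Ext1IsZero X Y :=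
  (Ext1IsZero.of_ses_left hY.op h''.op h'.op).unop

lemma IsCotorsionPair.ext1IsZero_s5 {S T : Set A} (h : IsCotorsionPair S T) {X Y : A}
    (hX : X ∈ S) (hY : Y ∈ T) : Ext1IsZero X Y := by
  rw [h.1] at hX
  exact hX Y hY

lemma IsCotorsionPair.left_of_ses {S T : Set A} (h : IsCotorsionPair S T) {X' X X'' : A}
    (hX : SES X' X X'') (h' : X' ∈ S) (h'' : X'' ∈ S) : X ∈ S := by
  rw [h.1]
  exact fun Y hY ↦ .of_ses_left hX (h.ext1IsZero_s5 h' hY) (h.ext1IsZero_s5 h'' hY)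

lemma IsCotorsionPair.right_of_ses {S T : Set A} (h : IsCotorsionPair S T) {Y' Y Y'' : A}
    (hY : SES Y' Y Y'') (h' : Y' ∈ T) (h'' : Y'' ∈ T) : Y ∈ T := by
  rw [h.2]
  exact fun X hX ↦ .of_ses_right hY (h.ext1IsZero_s5 hX h') (h.ext1IsZero_s5 hX h'')

variable {Q W R : Set A}

lemma IsHereditaryHoveyTriple.exists_ses_to_core (h : IsHereditaryHoveyTriple Q W R) {X : A}
    (hX : X ∈ Q ∩ R) : ∃ Wo Qq : A, Wo ∈ Q ∩ W ∩ R ∧ Qq ∈ Q ∩ R ∧ SES X Wo Qq := by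
  obtain ⟨⟨-, ⟨hQ, -, hQc⟩, -⟩, -, -, hR⟩ := h
  obtain ⟨Qq, Wo, hQq, hWo, hS⟩ := hQc X
  exact ⟨Wo, Qq, ⟨⟨hQ.left_of_ses hS hX.1 hQq, hWo.1⟩, hWo.2⟩,
    ⟨hQq, hR hX.2 hWo.2 hS⟩, hS⟩

lemma IsHereditaryHoveyTriple.exists_ses_from_core (h : IsHereditaryHoveyTriple Q W R) {X : A}
    (hX : X ∈ Q ∩ R) : ∃ Rr Wo : A, Wo ∈ Q ∩ W ∩ R ∧ Rr ∈ Q ∩ R ∧ SES Rr Wo X := by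
  obtain ⟨⟨-, -, hR, hRc, -⟩, ⟨hQ, -⟩, -⟩ := h
  obtain ⟨Wo, Rr, hWo, hRr, hS⟩ := hRc X
  exact ⟨Rr, Wo, ⟨hWo, hR.right_of_ses hS hRr hX.2⟩, ⟨hQ hWo.1 hX.1 hS, hRr⟩, hS⟩

end Ext1

end AbModel

/-- Proposition: for a hereditary Hovey triple `(Q, W, R)` in an abelian category `A`,
the full subcategory `Q ∩ R` with the short exact sequences having all terms in `Q ∩ R`
is a Frobenius category whose projective-injective objects are exactly the objects of the
core `ω = Q ∩ W ∩ R`.  Concretely: (1) such short exact sequences split when the first or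
the last term is in `ω`; (2) injective objects of `Q ∩ R` lie in `ω`; (3) projective
objects of `Q ∩ R` lie in `ω`; (4) `Q ∩ R` has enough injectives and enough projectives,
realized by objects of `ω`. -/
theorem frobenius_structure_of_hereditary_hovey_triple
    {A : Type*} [Category A] [Abelian A] {Q W R : Set A}
    (h : IsHereditaryHoveyTriple Q W R) :
    -- (1) admissible short exact sequences with first or last term in the core split
    (∀ ⦃X Y Z : A⦄ (f : X ⟶ Y) (g : Y ⟶ Z) (w : f ≫ g = 0),
      (ShortComplex.mk f g w).ShortExact →
      X ∈ Q ∩ R → Y ∈ Q ∩ R → Z ∈ Q ∩ R →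
      (X ∈ Q ∩ W ∩ R ∨ Z ∈ Q ∩ W ∩ R) →
      Nonempty (ShortComplex.mk f g w).Splitting) ∧
    -- (2) injective objects of the exact category Q ∩ R lie in the core
    (∀ I : A, I ∈ Q ∩ R →
      (∀ ⦃Y Z : A⦄ (f : I ⟶ Y) (g : Y ⟶ Z) (w : f ≫ g = 0),
        (ShortComplex.mk f g w).ShortExact → Y ∈ Q ∩ R → Z ∈ Q ∩ R →
        Nonempty (ShortComplex.mk f g w).Splitting) →
      I ∈ Q ∩ W ∩ R) ∧
    -- (3) projective objects of the exact category Q ∩ R lie in the core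
    (∀ P : A, P ∈ Q ∩ R →
      (∀ ⦃X Y : A⦄ (f : X ⟶ Y) (g : Y ⟶ P) (w : f ≫ g = 0),
        (ShortComplex.mk f g w).ShortExact → X ∈ Q ∩ R → Y ∈ Q ∩ R →
        Nonempty (ShortComplex.mk f g w).Splitting) →
      P ∈ Q ∩ W ∩ R) ∧
    -- (4) enough injectives and enough projectives relative to Q ∩ R, via the core
    (∀ X : A, X ∈ Q ∩ R →
      (∃ Wo Qq : A, Wo ∈ Q ∩ W ∩ R ∧ Qq ∈ Q ∩ R ∧ SES X Wo Qq) ∧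
      (∃ Rr Wo : A, Wo ∈ Q ∩ W ∩ R ∧ Rr ∈ Q ∩ R ∧ SES Rr Wo X)) := by
  have hW : IsThick W := h.1.1
  have hQ : IsCotorsionPair Q (W ∩ R) := h.1.2.1.1
  have hR : IsCotorsionPair (Q ∩ W) R := h.1.2.2.1
  refine ⟨?_, ?_, ?_, fun X hX ↦ ⟨h.exists_ses_to_core hX, h.exists_ses_from_core hX⟩⟩
  · rintro X Y Z f g w hS hX - hZ (hω | hω)
    · exact hQ.ext1IsZero_s5 hZ.1 ⟨hω.1.2, hω.2⟩ f g w hS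
    · exact hR.ext1IsZero_s5 hω.1 hX.2 f g w hS
  · intro I hI hsplit
    obtain ⟨Wo, Qq, hWo, hQq, f, g, w, hS⟩ := h.exists_ses_to_core hI
    obtain ⟨s⟩ := hsplit f g w hS ⟨hWo.1.1, hWo.2⟩ hQq
    exact ⟨⟨hI.1, hW.1 hWo.1.2 ⟨f, s.r, s.f_r⟩⟩, hI.2⟩
  · intro P hP hsplit
    obtain ⟨Rr, Wo, hWo, hRr, f, g, w, hS⟩ := h.exists_ses_from_core hP
    obtain ⟨s⟩ := hsplit f g w hS hRr ⟨hWo.1.1, hWo.2⟩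
    exact ⟨⟨hP.1, hW.1 hWo.1.2 ⟨s.s, g, s.s_g⟩⟩, hP.2⟩
end
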